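/- arXiv:math/0512382 — 2 statements merged into one kernel-verified Lean document; each statement's English description precedes it below -/
import Mathlib

section
/- Let $(S_0 = 0, S_1, \dots)$ be a martingale relative to a filtration $(H_{\le 0} \subseteq H_{\le 1} \subseteq \dots)$, and let $X_i := S_i - S_{i-1}$. Suppose that for every $i = 1, \dots, n$ there exist $H_{\le(i-1)}$-measurable random variables $C_{i-1}, D_{i-1}$ and a real number $s_i > 0$ such that $C_{i-1} \le X_i \le D_{i-1}$ and $D_{i-1} - C_{i-1} \le 2 s_i$ almost surely. Then for every real $t$, $\mathsf{E}\,|S_n - t|^5 \le \mathsf{E}\,|s Z - t|^5$, where $s := \sqrt{s_1^2 + \dots + s_n^2}$. -/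
open MeasureTheory ProbabilityTheory Real

lemma two_point_le_gaussian_poly {u m : ℝ} (hu : 1 ≤ u) (hm1 : -1 ≤ m) (hm2 : m ≤ 1)
    (ht : 5 / 8 ≤ u + m) :
    u ^ 5 + 10 * u ^ 3 + 5 * u + m * (5 * u ^ 4 + 10 * u ^ 2 + 1) ≤
      (u + m) ^ 5 + 10 * (u + m) ^ 3 + 15 * (u + m) := by
  rcases le_total 0 m with hm | hm
  · have : 0 ≤ 10 * u * (u * m + 1) ^ 2 + 10 * u ^ 2 * m ^ 3 + 5 * u * m ^ 4 + m ^ 5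
      + 30 * u * m ^ 2 + 10 * m ^ 3 + 14 * m := by positivity
    linarith [this]
  obtain ⟨t, rfl⟩ : ∃ t, u = t - m := ⟨u + m, by ring⟩
  obtain ⟨v, rfl⟩ : ∃ v, m = -v := ⟨-m, by ring⟩
  obtain ⟨q, hq⟩ : ∃ q, q = t * v := ⟨_, rfl⟩
  have ht : 5 / 8 ≤ t := by linarith
  have hv0 : 0 ≤ v := by linarith
  have hv1 : v ≤ 1 := by linarith
  have hq0 : 0 ≤ q := by rw [hq]; positivity
  suffices h : 0 ≤ 10 * t * (q - 1) ^ 2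
      + v * (20 * q ^ 2 - 10 * q - 4 + 15 * q * v ^ 2 + 4 * (v ^ 2) ^ 2) by
    subst hq; linarith [h]
  rcases le_total (2 * v) t with h2 | h2
  · have h1 : 10 * (2 * v) * (q - 1) ^ 2 ≤ 10 * t * (q - 1) ^ 2 := by gcongr
    have h3 : 0 ≤ v * (40 * q ^ 2 - 50 * q + 16 + 15 * q * v ^ 2 + 4 * (v ^ 2) ^ 2) := by
      apply mul_nonneg hv0
      have : 0 ≤ 15 * q * v ^ 2 + 4 * (v ^ 2) ^ 2 := by positivity
      nlinarith [sq_nonneg (q - 5 / 8)]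
    linarith
  rcases le_total v t with h3 | h3
  · have h1 : 10 * v * (q - 1) ^ 2 ≤ 10 * t * (q - 1) ^ 2 := by gcongr
    have h4 : q / 2 ≤ v ^ 2 := by rw [hq]; nlinarith
    have h5 : 15 * q * (q / 2) ≤ 15 * q * v ^ 2 := by gcongr
    have h6 : (q / 2) ^ 2 ≤ (v ^ 2) ^ 2 := by gcongr
    have h7 : 0 ≤ v * (10 * (q - 1) ^ 2
        + (20 * q ^ 2 - 10 * q - 4 + 15 * q * v ^ 2 + 4 * (v ^ 2) ^ 2)) := by
      apply mul_nonneg hv0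
      nlinarith [sq_nonneg (q - 15 / 38.5)]
    linarith
  · have h1 : 10 * (5 / 8 * v) * (q - 1) ^ 2 ≤ 10 * t * (q - 1) ^ 2 := by gcongr; linarith
    have h4 : q ≤ v ^ 2 := by rw [hq]; nlinarith
    have h5 : 15 * q * q ≤ 15 * q * v ^ 2 := by gcongr
    have h6 : q ^ 2 ≤ (v ^ 2) ^ 2 := by gcongr
    have h8 : 25 / 64 ≤ q := by rw [hq]; nlinarith
    have h7 : 0 ≤ v * (25 / 4 * (q - 1) ^ 2
        + (20 * q ^ 2 - 10 * q - 4 + 15 * q * v ^ 2 + 4 * (v ^ 2) ^ 2)) := by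
      apply mul_nonneg hv0
      nlinarith
    linarith

lemma two_point_le_quadratic_of_one_le {u m : ℝ} (hu : 1 ≤ u) (ht0 : 0 ≤ u + m)
    (ht : u + m ≤ 5 / 8) :
    u ^ 5 + 10 * u ^ 3 + 5 * u + m * (5 * u ^ 4 + 10 * u ^ 2 + 1) ≤
      6.376 + 15.94 * (u + m) ^ 2 := by
  obtain ⟨t, rfl⟩ : ∃ t, m = t - u := ⟨u + m, by ring⟩
  have ht0 : 0 ≤ t := by linarith
  have ht : t ≤ 5 / 8 := by linarith
  have ha : u ≤ u ^ 5 := le_self_pow₀ hu (by norm_num)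
  have hp : -4 * u ^ 5 + 4 * u + 5 / 8 * (5 * u ^ 4 + 10 * u ^ 2 + 1) ≤ 11.5 := by
    obtain ⟨p, rfl⟩ : ∃ p, u = 1 + p := ⟨u - 1, by ring⟩
    have hp : 0 ≤ p := by linarith
    have h3 : 0 ≤ p ^ 3 := by positivity
    have h4 : 0 ≤ p ^ 4 := by positivity
    have h5 : 0 ≤ p ^ 5 := by positivity
    nlinarith [sq_nonneg (p - 0.2), sq_nonneg p, mul_nonneg hp (sq_nonneg (p - 0.2))]
  have h1 : -4 * u ^ 5 + 4 * u + t * (5 * u ^ 4 + 10 * u ^ 2 + 1) ≤ 18.4 * t := by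
    nlinarith [mul_nonneg (sub_nonneg.2 ht) (sub_nonneg.2 ha), mul_le_mul_of_nonneg_left hp ht0]
  nlinarith [sq_nonneg (t - 0.6)]

lemma two_point_le_quadratic_of_le_one {u m : ℝ} (hu0 : 0 ≤ u) (hu : u ≤ 1) :
    1 + 10 * u ^ 2 + 5 * u ^ 4 + m * (5 * u + 10 * u ^ 3 + u ^ 5) ≤
      6.376 + 15.94 * (u + m) ^ 2 := by
  obtain ⟨t, rfl⟩ : ∃ t, m = t - u := ⟨u + m, by ring⟩
  have h3 : u ^ 3 ≤ 1 := pow_le_one₀ hu0 hu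
  have h5 : u ^ 5 ≤ 1 := pow_le_one₀ hu0 hu
  have h6 : 0 ≤ u ^ 6 := by positivity
  have hb : 0 ≤ 5 * u + 10 * u ^ 3 + u ^ 5 := by positivity
  have h1 : t * (5 * u + 10 * u ^ 3 + u ^ 5) ≤ 16 * |t| := by
    nlinarith [le_abs_self t, abs_nonneg t, mul_le_mul_of_nonneg_right (le_abs_self t) hb]
  have h2 : 0 ≤ 15.94 * t ^ 2 - 16 * |t| + 4.126 := by
    rw [← sq_abs t]; nlinarith [sq_nonneg (|t| - 0.502)]
  nlinarith [sq_nonneg (u ^ 2 - 1 / 2)]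

lemma integrable_abs_mul_sub_pow_gaussianReal (k : ℕ) (x c : ℝ) :
    Integrable (fun z : ℝ => |c * z - x| ^ k) (gaussianReal 0 1) := by
  have h : MemLp (fun z : ℝ => c * z - x) k (gaussianReal 0 1) :=
    ((memLp_id_gaussianReal' (μ := 0) (v := 1) k (by simp)).const_mul c).sub (memLp_const x)
  exact h.integrable_norm_pow'

lemma integral_abs_pow_gaussianReal (k : ℕ) :
    ∫ z, |z| ^ k ∂(gaussianReal 0 1) =
      2 ^ ((k : ℝ) / 2) * Gamma (((k : ℝ) + 1) / 2) / √π := by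
  rw [integral_gaussianReal_eq_integral_smul one_ne_zero]
  have h : ∀ z : ℝ, gaussianPDFReal 0 1 z • |z| ^ k =
      (fun y : ℝ => (√(2 * π))⁻¹ * (y ^ (k : ℝ) * rexp (-(1 / 2) * y ^ (2 : ℝ)))) |z| := by
    intro z
    simp [gaussianPDFReal]
    ring_nf
  rw [funext h]
  refine (integral_comp_abs (f := fun y : ℝ =>
    (√(2 * π))⁻¹ * (y ^ (k : ℝ) * rexp (-(1 / 2) * y ^ (2 : ℝ))))).trans ?_
  rw [integral_const_mul,
    integral_rpow_mul_exp_neg_mul_rpow (by norm_num) (by linarith [k.cast_nonneg (α := ℝ)])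
      (by norm_num)]
  have h2 : (1 / 2 : ℝ) ^ (-((k : ℝ) + 1) / 2) = 2 ^ ((k : ℝ) / 2) * √2 := by
    rw [one_div, inv_rpow (by norm_num), ← rpow_neg (by norm_num), sqrt_eq_rpow,
      ← rpow_add (by norm_num)]
    ring_nf
  rw [h2, sqrt_mul (by norm_num)]
  field_simp

lemma integral_odd_pow_gaussianReal (k : ℕ) (hk : Odd k) : ∫ z, z ^ k ∂(gaussianReal 0 1) = 0 := by
  have h := integral_map (μ := gaussianReal 0 1) (φ := fun z : ℝ => -z) (by fun_prop)
    (f := fun z : ℝ => z ^ k) (by fun_prop)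
  rw [gaussianReal_map_neg, neg_zero] at h
  simp only [hk.neg_pow, integral_neg] at h
  linarith

lemma integral_abs_sq_gaussianReal : ∫ z, |z| ^ 2 ∂(gaussianReal 0 1) = 1 := by
  rw [integral_abs_pow_gaussianReal, show (((2 : ℕ) : ℝ) + 1) / 2 = 1 / 2 + 1 by norm_num,
    Gamma_add_one (by norm_num), Gamma_one_half_eq]
  norm_num
  field_simp

lemma integral_abs_pow_four_gaussianReal : ∫ z, |z| ^ 4 ∂(gaussianReal 0 1) = 3 := by
  rw [integral_abs_pow_gaussianReal, show (((4 : ℕ) : ℝ) + 1) / 2 = 1 / 2 + 1 + 1 by norm_num,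
    Gamma_add_one (by norm_num), Gamma_add_one (by norm_num), Gamma_one_half_eq]
  norm_num
  field_simp
  norm_num

lemma le_sqrt_two_div_sqrt_pi : 0.797 ≤ √2 / √π := by
  rw [← sqrt_div (by norm_num)]
  apply le_sqrt_of_sq_le
  rw [le_div_iff₀ pi_pos]
  nlinarith [pi_lt_d4]

lemma le_integral_abs_pow_three_gaussianReal : 1.594 ≤ ∫ z, |z| ^ 3 ∂(gaussianReal 0 1) := by
  rw [integral_abs_pow_gaussianReal, show (((3 : ℕ) : ℝ) + 1) / 2 = (1 : ℕ) + 1 by norm_num,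
    Gamma_nat_eq_factorial, show ((3 : ℕ) : ℝ) / 2 = 1 + 1 / 2 by norm_num,
    rpow_add (by norm_num), ← sqrt_eq_rpow]
  norm_num
  have := le_sqrt_two_div_sqrt_pi
  rw [mul_div_assoc]
  norm_num at *
  linarith

lemma le_integral_abs_pow_five_gaussianReal : 6.376 ≤ ∫ z, |z| ^ 5 ∂(gaussianReal 0 1) := by
  rw [integral_abs_pow_gaussianReal, show (((5 : ℕ) : ℝ) + 1) / 2 = (2 : ℕ) + 1 by norm_num,
    Gamma_nat_eq_factorial, show ((5 : ℕ) : ℝ) / 2 = (2 : ℕ) + 1 / 2 by norm_num,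
    rpow_add (by norm_num), ← sqrt_eq_rpow, rpow_natCast]
  norm_num [Nat.factorial]
  have := le_sqrt_two_div_sqrt_pi
  have e : 4 * √2 * 2 / √π = 8 * (√2 / √π) := by ring
  rw [e]
  norm_num at *
  linarith

lemma poly_le_integral_abs_sub_pow_five (t : ℝ) :
    t ^ 5 + 10 * t ^ 3 + 15 * t ≤ ∫ z, |z - t| ^ 5 ∂(gaussianReal 0 1) := by
  have hi : ∀ k : ℕ, Integrable (fun z : ℝ => z ^ k) (gaussianReal 0 1) := fun k => by
    have := integrable_abs_mul_sub_pow_gaussianReal k 0 1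
    simp only [one_mul, sub_zero, ← abs_pow] at this
    exact (integrable_norm_iff (by fun_prop)).1 this
  have i1 := hi 1
  have i2 := hi 2
  have i3 := hi 3
  have i4 := hi 4
  have i5 := hi 5
  have e : ∫ z, (t ^ 5 + ((10 * t ^ 3) * z ^ 2 + ((5 * t) * z ^ 4 - ((5 * t ^ 4) * z ^ 1
      + ((10 * t ^ 2) * z ^ 3 + z ^ 5))))) ∂(gaussianReal 0 1) = t ^ 5 + 10 * t ^ 3 + 15 * t := by
    have h2 := integral_abs_sq_gaussianReal
    have h4 := integral_abs_pow_four_gaussianReal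
    simp only [sq_abs] at h2
    simp only [Even.pow_abs (show Even 4 by decide)] at h4
    rw [integral_add (by fun_prop), integral_add, integral_sub, integral_add, integral_add]
    · simp only [integral_const_mul, h2, h4, integral_odd_pow_gaussianReal 1 (by decide),
        integral_odd_pow_gaussianReal 3 (by decide), integral_odd_pow_gaussianReal 5 (by decide)]
      simp; ring
    all_goals fun_prop
  rw [← e]
  apply integral_mono
  · fun_prop
  · simpa using integrable_abs_mul_sub_pow_gaussianReal 5 t 1
  · intro z
    have : (t - z) ^ 5 ≤ |z - t| ^ 5 := by
      rw [abs_sub_comm, ← abs_pow]; exact le_abs_self _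
    simp only
    linarith

lemma integral_abs_sub_neg_pow_five (t : ℝ) :
    ∫ z, |z - -t| ^ 5 ∂(gaussianReal 0 1) = ∫ z, |z - t| ^ 5 ∂(gaussianReal 0 1) := by
  have h := integral_map (μ := gaussianReal 0 1) (φ := fun z : ℝ => -z) (by fun_prop)
    (f := fun z : ℝ => |z - t| ^ 5) (by fun_prop)
  rw [gaussianReal_map_neg, neg_zero] at h
  rw [h]
  congr 1 with z
  rw [← abs_neg]; ring_nf

lemma quadratic_le_integral_abs_sub_pow_five (t : ℝ) :
    6.376 + 15.94 * t ^ 2 ≤ ∫ z, |z - t| ^ 5 ∂(gaussianReal 0 1) := by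
  have hi : ∀ k : ℕ, Integrable (fun z : ℝ => |z| ^ k) (gaussianReal 0 1) := fun k => by
    simpa using integrable_abs_mul_sub_pow_gaussianReal k 0 1
  have hj : ∀ t : ℝ, Integrable (fun z : ℝ => |z - t| ^ 5) (gaussianReal 0 1) := fun t => by
    simpa using integrable_abs_mul_sub_pow_gaussianReal 5 t 1
  have h : ∫ z, (2 * |z| ^ 5 + (20 * t ^ 2) * |z| ^ 3) ∂(gaussianReal 0 1) ≤
      ∫ z, (|z - t| ^ 5 + |z - -t| ^ 5) ∂(gaussianReal 0 1) := by
    apply integral_mono (((hi 5).const_mul _).add ((hi 3).const_mul _)) ((hj t).add (hj (-t)))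
    intro z
    have key : ∀ a b : ℝ, 0 ≤ a → 2 * a ^ 5 + 20 * b ^ 2 * a ^ 3 ≤ |a - b| ^ 5 + |a + b| ^ 5 := by
      intro a b ha
      have h1 : (a - b) ^ 5 ≤ |a - b| ^ 5 := by rw [← abs_pow]; exact le_abs_self _
      have h2 : (a + b) ^ 5 ≤ |a + b| ^ 5 := by rw [← abs_pow]; exact le_abs_self _
      have h3 : 0 ≤ a * b ^ 4 := by positivity
      linarith
    change 2 * |z| ^ 5 + 20 * t ^ 2 * |z| ^ 3 ≤ |z - t| ^ 5 + |z - -t| ^ 5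
    rw [sub_neg_eq_add]
    rcases abs_cases z with ⟨hz, h0⟩ | ⟨hz, h0⟩
    · rw [hz]; exact key z t h0
    · rw [hz]
      refine (key (-z) t (by linarith)).trans (le_of_eq ?_)
      rw [← abs_neg (-z - t), ← abs_neg (-z + t)]; ring_nf
  rw [integral_add ((hi 5).const_mul _) ((hi 3).const_mul _), integral_const_mul,
    integral_const_mul, integral_add (hj t) (hj (-t)), integral_abs_sub_neg_pow_five] at h
  nlinarith [le_integral_abs_pow_three_gaussianReal, le_integral_abs_pow_five_gaussianReal,
    mul_le_mul_of_nonneg_left le_integral_abs_pow_three_gaussianReal (sq_nonneg t)]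

lemma two_point_le_integral_gaussianReal {u m : ℝ} (hm1 : -1 ≤ m) (hm2 : m ≤ 1) :
    (|1 - u| ^ 5 + |1 + u| ^ 5) / 2 + m * ((|1 + u| ^ 5 - |1 - u| ^ 5) / 2) ≤
      ∫ z, |z - (u + m)| ^ 5 ∂(gaussianReal 0 1) := by
  wlog hu : 0 ≤ u generalizing u m
  · have := this (u := -u) (m := -m) (by linarith) (by linarith) (by linarith)
    rw [← neg_add, integral_abs_sub_neg_pow_five, sub_neg_eq_add, ← sub_eq_add_neg] at this
    linarith
  rw [abs_of_nonneg (by linarith : 0 ≤ 1 + u)]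
  rcases le_total u 1 with h1 | h1
  · rw [abs_of_nonneg (by linarith : 0 ≤ 1 - u)]
    linarith [two_point_le_quadratic_of_le_one (m := m) hu h1,
      quadratic_le_integral_abs_sub_pow_five (u + m)]
  · rw [abs_of_nonpos (by linarith : 1 - u ≤ 0)]
    rcases le_total (u + m) (5 / 8) with h2 | h2
    · linarith [two_point_le_quadratic_of_one_le h1 (by linarith) h2,
        quadratic_le_integral_abs_sub_pow_five (u + m)]
    · linarith [two_point_le_gaussian_poly h1 hm1 hm2 h2, poly_le_integral_abs_sub_pow_five (u + m)]

lemma integral_integral_abs_pow_five_gaussianReal (a b t : ℝ) :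
    ∫ z, ∫ w, |a * w + b * z - t| ^ 5 ∂(gaussianReal 0 1) ∂(gaussianReal 0 1) =
      ∫ z, |√(a ^ 2 + b ^ 2) * z - t| ^ 5 ∂(gaussianReal 0 1) := by
  have hmap : ∀ c : ℝ, (gaussianReal 0 1).map (c * ·) =
      gaussianReal 0 (NNReal.mk (c ^ 2) (sq_nonneg c)) := by
    intro c
    rw [gaussianReal_map_const_mul]
    simp
  have hI : ∀ (c : ℝ) (f : ℝ → ℝ), Continuous f →
      ∫ z, f (c * z) ∂(gaussianReal 0 1) =
        ∫ y, f y ∂(gaussianReal 0 (NNReal.mk (c ^ 2) (sq_nonneg c))) := by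
    intro c f hf
    rw [← hmap, integral_map (by fun_prop) hf.aestronglyMeasurable]
  have hint : Integrable (fun y => |y - t| ^ 5)
      (gaussianReal 0 (NNReal.mk (b ^ 2) (sq_nonneg b)) ∗
        gaussianReal 0 (NNReal.mk (a ^ 2) (sq_nonneg a))) := by
    rw [gaussianReal_conv_gaussianReal]
    exact ((memLp_id_gaussianReal' 5 (by simp)).sub (memLp_const t)).integrable_norm_pow'
  have h1 := integral_conv hint
  rw [gaussianReal_conv_gaussianReal, add_zero] at h1
  rw [hI (√(a ^ 2 + b ^ 2)) (fun y => |y - t| ^ 5) (by fun_prop)]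
  have hv : (NNReal.mk (√(a ^ 2 + b ^ 2) ^ 2) (sq_nonneg _)) =
      (NNReal.mk (b ^ 2) (sq_nonneg b)) + (NNReal.mk (a ^ 2) (sq_nonneg a)) := by
    ext
    change √(a ^ 2 + b ^ 2) ^ 2 = b ^ 2 + a ^ 2
    rw [sq_sqrt (by positivity), add_comm]
  rw [hv, h1, ← hmap b, integral_map (by fun_prop)]
  · congr 1 with z
    rw [← hI a (fun w => |b * z + w - t| ^ 5) (by fun_prop)]
    simp only [add_comm]
  · exact (show StronglyMeasurable (Function.uncurry fun x y : ℝ => |x + y - t| ^ 5) by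
      fun_prop).integral_prod_right.aestronglyMeasurable

lemma abs_add_pow_five_le_chord {s x y : ℝ} (hs : 0 < s) (hx : |x| ≤ s) :
    |y + x| ^ 5 ≤ (|y - s| ^ 5 + |y + s| ^ 5) / 2 + (|y + s| ^ 5 - |y - s| ^ 5) / 2 / s * x := by
  have hc : ConvexOn ℝ Set.univ (fun z : ℝ => ‖z‖ ^ 5) :=
    (convexOn_univ_norm (E := ℝ)).pow (fun _ _ => norm_nonneg _) 5
  have hx' := abs_le.1 hx
  obtain ⟨-, hc⟩ := hc
  have h := hc (Set.mem_univ (y - s)) (Set.mem_univ (y + s))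
    (a := (s - x) / (2 * s)) (b := (s + x) / (2 * s))
    (div_nonneg (by linarith) (by linarith)) (div_nonneg (by linarith) (by linarith))
    (by field_simp; ring)
  simp only [smul_eq_mul, norm_eq_abs] at h
  have e : (s - x) / (2 * s) * (y - s) + (s + x) / (2 * s) * (y + s) = y + x := by
    field_simp; ring
  rw [e] at h
  refine h.trans (le_of_eq ?_)
  field_simp
  ring

lemma two_point_le_integral_gaussianReal_scaled {s y M : ℝ} (hs : 0 < s) (hM : |M| ≤ s) :
    (|y + M - s| ^ 5 + |y + M + s| ^ 5) / 2
      - (|y + M + s| ^ 5 - |y + M - s| ^ 5) / 2 / s * M ≤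
      ∫ z, |y + s * z| ^ 5 ∂(gaussianReal 0 1) := by
  have hM' := abs_le.1 hM
  have h := two_point_le_integral_gaussianReal (u := (y + M) / s) (m := -(M / s))
    (by rw [neg_le_neg_iff, div_le_one hs]; exact hM'.2)
    (by rw [neg_le, le_div_iff₀ hs]; linarith)
  have e : (y + M) / s + -(M / s) = -(-(y / s)) := by field_simp; ring
  rw [e, integral_abs_sub_neg_pow_five] at h
  have h2 : ∀ w : ℝ, |w| ^ 5 * s ^ 5 = |w * s| ^ 5 := fun w => by
    rw [abs_mul, mul_pow, abs_of_pos hs]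
  have h3 := mul_le_mul_of_nonneg_right h (pow_nonneg hs.le 5)
  rw [← integral_mul_const] at h3
  simp only [h2] at h3
  have e1 : ∀ z, (z - -(y / s)) * s = y + s * z := fun z => by field_simp; ring
  simp only [e1] at h3
  refine le_trans (le_of_eq ?_) h3
  rw [show |y + M - s| = |(1 - (y + M) / s) * s| by rw [← abs_neg]; congr 1; field_simp; ring,
    show |y + M + s| = |(1 + (y + M) / s) * s| by congr 1; field_simp; ring]
  rw [← h2, ← h2]
  ring

lemma integrable_abs_pow_five_prod_gaussianReal {Ω : Type*} {m0 : MeasurableSpace Ω} {μ : Measure Ω}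
    [IsProbabilityMeasure μ] {Y : Ω → ℝ} (hY : MemLp Y 5 μ) (s t : ℝ) :
    Integrable (fun p : Ω × ℝ => |Y p.1 + s * p.2 - t| ^ 5) (μ.prod (gaussianReal 0 1)) := by
  have h1 : MemLp (fun p : Ω × ℝ => Y p.1) 5 (μ.prod (gaussianReal 0 1)) :=
    hY.comp_measurePreserving measurePreserving_fst
  have h2 : MemLp (fun p : Ω × ℝ => p.2) 5 (μ.prod (gaussianReal 0 1)) :=
    (memLp_id_gaussianReal' 5 (by simp)).comp_measurePreserving measurePreserving_snd
  exact ((h1.add (h2.const_mul s)).sub (memLp_const t)).integrable_norm_pow'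

lemma integrable_and_abs_le_of_condExp_eq_zero {Ω : Type*} {m m0 : MeasurableSpace Ω}
    {μ : Measure Ω} [IsProbabilityMeasure μ] (hm : m ≤ m0) {X M : Ω → ℝ} {s : ℝ}
    (hM : StronglyMeasurable[m] M) (hX : Integrable X μ) (hX0 : μ[X | m] =ᵐ[μ] 0)
    (hXM : ∀ᵐ ω ∂μ, |X ω - M ω| ≤ s) : Integrable M μ ∧ ∀ᵐ ω ∂μ, |M ω| ≤ s := by
  have hMi : Integrable M μ := by
    have h : Integrable (X - M) μ :=
      Integrable.of_bound (hX.aestronglyMeasurable.sub (hM.mono hm).aestronglyMeasurable) s hXM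
    simpa using hX.sub h
  refine ⟨hMi, ?_⟩
  have h1 := ae_bdd_abs_condExp_of_ae_bdd_abs (R := s) (m := m) (f := X - M) hXM
  have h2 := condExp_sub hX hMi m
  rw [condExp_of_stronglyMeasurable hm hM hMi] at h2
  filter_upwards [h1, h2, hX0] with ω h1 h2 h3
  rw [h2] at h1
  simpa only [Pi.sub_apply, h3, Pi.zero_apply, zero_sub, abs_neg] using h1

lemma integral_abs_pow_five_add_le_gaussianReal {Ω : Type*} {m m0 : MeasurableSpace Ω}
    {μ : Measure Ω} [IsProbabilityMeasure μ] (hm : m ≤ m0) {Y X M : Ω → ℝ} {K s : ℝ} (hs : 0 < s)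
    (hY : StronglyMeasurable[m] Y) (hYK : ∀ᵐ ω ∂μ, |Y ω| ≤ K) (hM : StronglyMeasurable[m] M)
    (hX : Integrable X μ) (hX0 : μ[X | m] =ᵐ[μ] 0) (hXM : ∀ᵐ ω ∂μ, |X ω - M ω| ≤ s) (t : ℝ) :
    ∫ ω, |Y ω + X ω - t| ^ 5 ∂μ ≤
      ∫ ω, ∫ z, |Y ω + s * z - t| ^ 5 ∂(gaussianReal 0 1) ∂μ := by
  obtain ⟨hMi, hMs⟩ := integrable_and_abs_le_of_condExp_eq_zero hm hM hX hX0 hXM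
  set a : Ω → ℝ := fun ω => |Y ω - t + M ω - s| ^ 5 with ha
  set b : Ω → ℝ := fun ω => |Y ω - t + M ω + s| ^ 5 with hb
  have ham : StronglyMeasurable[m] a :=
    (continuous_abs.pow 5).comp_stronglyMeasurable
      (((hY.sub stronglyMeasurable_const).add hM).sub stronglyMeasurable_const)
  have hbm : StronglyMeasurable[m] b :=
    (continuous_abs.pow 5).comp_stronglyMeasurable
      (((hY.sub stronglyMeasurable_const).add hM).add stronglyMeasurable_const)
  set L := (K + |t| + s + s) ^ 5 with hL
  have hbd : ∀ᵐ ω ∂μ, |a ω| ≤ L ∧ |b ω| ≤ L := by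
    filter_upwards [hYK, hMs] with ω h1 h2
    have h3 := abs_le.1 h1
    have h4 := abs_le.1 h2
    have h5 := neg_abs_le t
    have h6 := le_abs_self t
    simp only [ha, hb, hL, abs_pow, abs_abs]
    constructor <;> apply pow_le_pow_left₀ (abs_nonneg _) <;> rw [abs_le] <;>
       constructor <;> linarith
  have hai : Integrable a μ :=
    .of_bound (ham.mono hm).aestronglyMeasurable L (hbd.mono fun _ h => h.1)
  have hbi : Integrable b μ :=
    .of_bound (hbm.mono hm).aestronglyMeasurable L (hbd.mono fun _ h => h.2)
  set B : Ω → ℝ := fun ω => (b ω - a ω) / 2 / s with hB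
  have hBm : StronglyMeasurable[m] B :=
    ((continuous_id.div_const 2).div_const s).comp_stronglyMeasurable (hbm.sub ham)
  have hBb : ∀ᵐ ω ∂μ, ‖B ω‖ ≤ (L + L) / 2 / s := by
    filter_upwards [hbd] with ω h
    rw [hB, norm_eq_abs, abs_div, abs_div, abs_of_pos hs, abs_of_pos (two_pos (α := ℝ))]
    gcongr
    exact (abs_sub _ _).trans (add_le_add h.2 h.1)
  have hBX : Integrable (B * X) μ := hX.bdd_mul (hBm.mono hm).aestronglyMeasurable hBb
  have hBM : Integrable (B * M) μ := hMi.bdd_mul (hBm.mono hm).aestronglyMeasurable hBb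
  have hBX0 : ∫ ω, (B * X) ω ∂μ = 0 := by
    rw [← integral_condExp hm, integral_congr_ae
      ((condExp_mul_of_stronglyMeasurable_left hBm hBX hX).trans (hX0.mono fun ω h => ?_)
        : _ =ᵐ[μ] fun _ => (0 : ℝ))]
    · simp
    · simp [h]
  have hA : Integrable (fun ω => (a ω + b ω) / 2) μ := (hai.add hbi).div_const 2
  have hYL : MemLp Y 5 μ := .of_bound (hY.mono hm).aestronglyMeasurable K hYK
  calc ∫ ω, |Y ω + X ω - t| ^ 5 ∂μ
      ≤ ∫ ω, (((a ω + b ω) / 2 - (B * M) ω) + (B * X) ω) ∂μ := by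
        apply integral_mono_of_nonneg (.of_forall fun ω => by positivity)
          ((hA.sub hBM).add hBX)
        filter_upwards [hXM] with ω h
        have := abs_add_pow_five_le_chord (y := Y ω - t + M ω) hs h
        rw [show Y ω - t + M ω + (X ω - M ω) = Y ω + X ω - t by ring] at this
        change |Y ω + X ω - t| ^ 5 ≤ (a ω + b ω) / 2 - B ω * M ω + B ω * X ω
        linarith
    _ = ∫ ω, ((a ω + b ω) / 2 - (B * M) ω) ∂μ := by
        refine (integral_add (hA.sub hBM) hBX).trans ?_
        rw [hBX0, add_zero]
        rfl
    _ ≤ _ := by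
        apply integral_mono_ae (hA.sub hBM)
          (integrable_abs_pow_five_prod_gaussianReal hYL s t).integral_prod_left
        filter_upwards [hMs] with ω h
        have := two_point_le_integral_gaussianReal_scaled (y := Y ω - t) hs h
        simp only [show ∀ z, Y ω - t + s * z = Y ω + s * z - t from fun z => by ring] at this
        exact this

/-- two-sided moment comparison for bounded-difference martingales. -/
theorem martingale_abs_moment_comparison
    {Ω : Type*} {m0 : MeasurableSpace Ω} {μ : Measure Ω} [IsProbabilityMeasure μ]
    (ℱ : Filtration ℕ m0) (S : ℕ → Ω → ℝ) (hS : Martingale S ℱ μ)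
    (hS0 : ∀ᵐ ω ∂μ, S 0 ω = 0)
    (n : ℕ) (C D : ℕ → Ω → ℝ) (s : ℕ → ℝ)
    (hs : ∀ i ∈ Finset.Icc 1 n, 0 < s i)
    (hCmeas : ∀ i ∈ Finset.Icc 1 n, StronglyMeasurable[ℱ (i - 1)] (C (i - 1)))
    (hDmeas : ∀ i ∈ Finset.Icc 1 n, StronglyMeasurable[ℱ (i - 1)] (D (i - 1)))
    (hCD : ∀ i ∈ Finset.Icc 1 n, ∀ᵐ ω ∂μ,
      C (i - 1) ω ≤ S i ω - S (i - 1) ω ∧ S i ω - S (i - 1) ω ≤ D (i - 1) ω ∧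
        D (i - 1) ω - C (i - 1) ω ≤ 2 * s i)
    (t : ℝ) :
    ∫ ω, |S n ω - t| ^ 5 ∂μ ≤
      ∫ z, |Real.sqrt (∑ i ∈ Finset.Icc 1 n, s i ^ 2) * z - t| ^ 5
        ∂(gaussianReal 0 1) := by
  suffices H : ∀ k ≤ n, (∃ K : ℝ, ∀ᵐ ω ∂μ, |S k ω| ≤ K) ∧ ∀ t : ℝ,
      ∫ ω, |S k ω - t| ^ 5 ∂μ ≤
        ∫ z, |√(∑ i ∈ Finset.Icc 1 k, s i ^ 2) * z - t| ^ 5 ∂(gaussianReal 0 1) from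
    (H n le_rfl).2 t
  intro k
  induction k with
  | zero =>
    refine fun _ => ⟨⟨0, hS0.mono fun ω h => by simp [h]⟩, fun t => ?_⟩
    rw [integral_congr_ae (g := fun _ => |t| ^ 5) (hS0.mono fun ω h => by simp [h])]
    simp
  | succ k ih =>
    intro hk
    obtain ⟨⟨K, hK⟩, ih⟩ := ih (by omega)
    have hmem : k + 1 ∈ Finset.Icc 1 n := by simp; omega
    have hs' := hs _ hmem
    have hC := hCmeas _ hmem
    have hD := hDmeas _ hmem
    have hX := hCD _ hmem
    rw [Nat.add_sub_cancel] at hC hD hX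
    set M : Ω → ℝ := fun ω => (2 : ℝ)⁻¹ * (C k ω + D k ω) with hMdef
    have hM : StronglyMeasurable[ℱ k] M := (hC.add hD).const_mul _
    have hXi : Integrable (S (k + 1) - S k) μ := (hS.integrable _).sub (hS.integrable _)
    have hX0 : μ[S (k + 1) - S k | ℱ k] =ᵐ[μ] 0 := by
      filter_upwards [condExp_sub (hS.integrable (k + 1)) (hS.integrable k) (ℱ k),
        hS.condExp_ae_eq (Nat.le_succ k), hS.condExp_ae_eq (le_refl k)] with ω h1 h2 h3
      rw [h1, Pi.sub_apply, h2, h3, sub_self, Pi.zero_apply]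
    have hXM : ∀ᵐ ω ∂μ, |(S (k + 1) - S k) ω - M ω| ≤ s (k + 1) := by
      filter_upwards [hX] with ω h
      rw [Pi.sub_apply, hMdef, abs_le]
      constructor <;> linarith
    refine ⟨⟨K + 2 * s (k + 1), ?_⟩, fun t => ?_⟩
    · filter_upwards [hK, hXM,
        (integrable_and_abs_le_of_condExp_eq_zero (ℱ.le k) hM hXi hX0 hXM).2] with ω h1 h2 h3
      rw [Pi.sub_apply] at h2
      rw [abs_le] at *
      constructor <;> linarith [h1.1, h1.2, h2.1, h2.2, h3.1, h3.2]
    have hYL : MemLp (S k) 5 μ := .of_bound (hS.integrable k).aestronglyMeasurable K hK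
    have hP := integrable_abs_pow_five_prod_gaussianReal hYL (s (k + 1)) t
    have hW : MemLp (fun w => √(∑ i ∈ Finset.Icc 1 k, s i ^ 2) * w) 5 (gaussianReal 0 1) :=
      (memLp_id_gaussianReal' 5 (by simp)).const_mul _
    have hQ := integrable_abs_pow_five_prod_gaussianReal hW (s (k + 1)) t
    calc ∫ ω, |S (k + 1) ω - t| ^ 5 ∂μ
        = ∫ ω, |S k ω + (S (k + 1) - S k) ω - t| ^ 5 ∂μ := by simp
      _ ≤ ∫ ω, ∫ z, |S k ω + s (k + 1) * z - t| ^ 5 ∂(gaussianReal 0 1) ∂μ :=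
          integral_abs_pow_five_add_le_gaussianReal (ℱ.le k) hs' (hS.stronglyMeasurable k)
            hK hM hXi hX0 hXM t
      _ = ∫ z, ∫ ω, |S k ω + s (k + 1) * z - t| ^ 5 ∂μ ∂(gaussianReal 0 1) :=
          integral_integral_swap hP
      _ ≤ ∫ z, ∫ w, |√(∑ i ∈ Finset.Icc 1 k, s i ^ 2) * w + s (k + 1) * z - t| ^ 5
            ∂(gaussianReal 0 1) ∂(gaussianReal 0 1) := by
          apply integral_mono hP.integral_prod_right hQ.integral_prod_right
          intro z
          simpa only [← add_sub_assoc', sub_sub_eq_add_sub] using ih (t - s (k + 1) * z)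
      _ = _ := by
          rw [integral_integral_abs_pow_five_gaussianReal,
            sq_sqrt (Finset.sum_nonneg fun i _ => sq_nonneg _),
            Finset.sum_Icc_succ_top (by omega)]
end

section
/- For every $r \in [0,1]$ and every real $t$, $r\,\max(0,\, 2r - 2 - t)^5 + (1-r)\,\max(0,\, 2r - t)^5 \le (8 + 9t^2 + t^4)\,\varphi(t) - t\,(15 + 10 t^2 + t^4)\,\Psi(t)$, where $\varphi(t) := (2\pi)^{-1/2} e^{-t^2/2}$ is the standard normal density and $\Psi(t) := \int_t^\infty \varphi(u)\, du$ is the standard normal tail function. (The right-hand side equals $\mathsf{E}\,\max(0, Z - t)^5$ for a standard normal $Z$.) -/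
open Real

/-- The unnormalized Gaussian tail `∫ u > t, exp (-u² / 2)`. -/
noncomputable def gaussTail (t : ℝ) : ℝ := ∫ u in Set.Ioi t, exp (-(u ^ 2) / 2)

/-- The fifth one-sided moment `∫ u > t, (u - t)⁵ exp (-u² / 2)`, in closed form. -/
noncomputable def gaussMoment (t : ℝ) : ℝ :=
  (8 + 9 * t ^ 2 + t ^ 4) * exp (-(t ^ 2) / 2) -
    t * (15 + 10 * t ^ 2 + t ^ 4) * gaussTail t

lemma integrable_exp_neg_sq_div_two :
    MeasureTheory.Integrable (fun u : ℝ => exp (-(u ^ 2) / 2)) := by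
  convert integrable_exp_neg_mul_sq (b := 1 / 2) (by norm_num) using 3
  ring

lemma gaussTail_zero : gaussTail 0 = √(2 * π) / 2 := by
  have h := integral_gaussian_Ioi (1 / 2)
  rw [show π / (1 / 2) = 2 * π by ring] at h
  rw [← h, gaussTail]
  congr 1 with u
  ring_nf

lemma gaussTail_neg (t : ℝ) : gaussTail (-t) = √(2 * π) - gaussTail t := by
  have h1 : ∫ u in Set.Iic t, exp (-(u ^ 2) / 2) = gaussTail (-t) := by
    have h := integral_comp_neg_Iic t (fun u : ℝ => exp (-(u ^ 2) / 2))
    simpa [gaussTail] using h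
  have h2 := intervalIntegral.integral_Iic_add_Ioi (b := t)
    integrable_exp_neg_sq_div_two.integrableOn integrable_exp_neg_sq_div_two.integrableOn
  have h3 := integral_gaussian (1 / 2)
  rw [show π / (1 / 2) = 2 * π by ring] at h3
  have h4 : ∫ u : ℝ, exp (-(u ^ 2) / 2) = √(2 * π) := by
    rw [← h3]
    congr 1 with u
    ring_nf
  rw [h1, h4] at h2
  rw [← h2, gaussTail, gaussTail]
  ring

lemma gaussTail_sub_gaussTail (a b : ℝ) :
    gaussTail a - gaussTail b = ∫ u in a..b, exp (-(u ^ 2) / 2) :=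
  intervalIntegral.integral_Ioi_sub_Ioi' integrable_exp_neg_sq_div_two.integrableOn
    integrable_exp_neg_sq_div_two.integrableOn

lemma hasDerivAt_gaussTail (x : ℝ) : HasDerivAt gaussTail (-exp (-(x ^ 2) / 2)) x := by
  have hc : Continuous fun u : ℝ => exp (-(u ^ 2) / 2) := by fun_prop
  have h := (hc.integral_hasStrictDerivAt 0 x).hasDerivAt.const_sub (gaussTail 0)
  refine h.congr_of_eventuallyEq (Filter.Eventually.of_forall fun y => ?_)
  simp only [← gaussTail_sub_gaussTail]
  ring

lemma tendsto_gaussTail : Filter.Tendsto gaussTail Filter.atTop (nhds 0) :=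
  MeasureTheory.tendsto_integral_Ioi_zero Filter.tendsto_id

lemma tendsto_pow_mul_exp_neg_sq_div_two (n : ℕ) :
    Filter.Tendsto (fun x : ℝ => x ^ n * exp (-(x ^ 2) / 2)) Filter.atTop (nhds 0) := by
  refine squeeze_zero' ?_ ?_ (tendsto_pow_mul_exp_neg_atTop_nhds_zero n)
  · filter_upwards [Filter.eventually_ge_atTop 0] with x hx
    positivity
  · filter_upwards [Filter.eventually_ge_atTop 2] with x hx
    gcongr
    nlinarith

lemma one_sub_pow_le_exp {x : ℝ} (h0 : 0 ≤ x) (h3 : x ≤ 3) :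
    (1 - x ^ 2 / 12) ^ 6 ≤ exp (-(x ^ 2) / 2) := by
  have h : 1 - x ^ 2 / 12 ≤ exp (-(x ^ 2) / 12) := by
    have := add_one_le_exp (-(x ^ 2) / 12)
    linarith
  calc (1 - x ^ 2 / 12) ^ 6 ≤ exp (-(x ^ 2) / 12) ^ 6 :=
        pow_le_pow_left₀ (by nlinarith) h 6
    _ = exp (-(x ^ 2) / 2) := by
        rw [← exp_nat_mul]
        congr 1
        push_cast
        ring

lemma cubic_taylor_le_exp {x : ℝ} (h0 : 0 ≤ x) (h1 : x ≤ 1) :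
    1 - x ^ 2 / 2 + x ^ 4 / 8 - x ^ 6 / 48 ≤ exp (-(x ^ 2) / 2) := by
  have hx : x ^ 2 ≤ 1 := by nlinarith
  have h := Real.exp_bound (x := -(x ^ 2) / 2) (n := 5)
    (by rw [abs_le]; constructor <;> nlinarith [sq_nonneg x]) (by norm_num)
  have h2 := (abs_le.mp h).1
  have h3 : |-(x ^ 2) / 2| = x ^ 2 / 2 := by
    rw [neg_div, abs_neg, abs_of_nonneg (by positivity)]
  rw [h3] at h2
  simp only [Finset.sum_range_succ, Finset.sum_range_zero, Nat.factorial] at h2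
  norm_num at h2
  have h4 : x ^ 10 ≤ x ^ 8 := pow_le_pow_of_le_one h0 h1 (by norm_num)
  have h5 : 0 ≤ x ^ 8 := by positivity
  ring_nf at h2 ⊢
  linarith

/-- With `t` fixed, a primitive of `-(x - t)⁵ exp (-x² / 2)` vanishing at infinity. -/
noncomputable def gaussMomentPrimitive (t x : ℝ) : ℝ :=
  (x ^ 4 - 5 * t * x ^ 3 + (10 * t ^ 2 + 4) * x ^ 2 - (10 * t ^ 3 + 15 * t) * x +
      (5 * t ^ 4 + 20 * t ^ 2 + 8)) * exp (-(x ^ 2) / 2) -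
    t * (15 + 10 * t ^ 2 + t ^ 4) * gaussTail x

lemma gaussMomentPrimitive_self (t : ℝ) : gaussMomentPrimitive t t = gaussMoment t := by
  unfold gaussMomentPrimitive gaussMoment
  ring

lemma hasDerivAt_gaussMomentPrimitive (t x : ℝ) :
    HasDerivAt (gaussMomentPrimitive t) (-((x - t) ^ 5 * exp (-(x ^ 2) / 2))) x := by
  have he : HasDerivAt (fun x : ℝ => exp (-(x ^ 2) / 2)) (exp (-(x ^ 2) / 2) * -x) x := by
    refine ((hasDerivAt_pow 2 x).fun_neg.div_const 2).exp.congr_deriv ?_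
    norm_num
    ring
  have hq : HasDerivAt (fun x : ℝ => x ^ 4 - 5 * t * x ^ 3 + (10 * t ^ 2 + 4) * x ^ 2 -
      (10 * t ^ 3 + 15 * t) * x + (5 * t ^ 4 + 20 * t ^ 2 + 8))
      (4 * x ^ 3 - 5 * t * (3 * x ^ 2) + (10 * t ^ 2 + 4) * (2 * x) - (10 * t ^ 3 + 15 * t)) x := by
    refine (((((hasDerivAt_pow 4 x).sub ((hasDerivAt_pow 3 x).const_mul (5 * t))).add
      ((hasDerivAt_pow 2 x).const_mul (10 * t ^ 2 + 4))).sub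
      ((hasDerivAt_id x).const_mul (10 * t ^ 3 + 15 * t))).add_const
      (5 * t ^ 4 + 20 * t ^ 2 + 8)).congr_deriv ?_
    norm_num
  refine ((hq.mul he).sub ((hasDerivAt_gaussTail x).const_mul
    (t * (15 + 10 * t ^ 2 + t ^ 4)))).congr_deriv ?_
  ring

lemma tendsto_gaussMomentPrimitive (t : ℝ) :
    Filter.Tendsto (gaussMomentPrimitive t) Filter.atTop (nhds 0) := by
  have h := (((((tendsto_pow_mul_exp_neg_sq_div_two 4).sub
    ((tendsto_pow_mul_exp_neg_sq_div_two 3).const_mul (5 * t))).add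
    ((tendsto_pow_mul_exp_neg_sq_div_two 2).const_mul (10 * t ^ 2 + 4))).sub
    ((tendsto_pow_mul_exp_neg_sq_div_two 1).const_mul (10 * t ^ 3 + 15 * t))).add
    ((tendsto_pow_mul_exp_neg_sq_div_two 0).const_mul (5 * t ^ 4 + 20 * t ^ 2 + 8))).sub
    (tendsto_gaussTail.const_mul (t * (15 + 10 * t ^ 2 + t ^ 4)))
  simp only [mul_zero, sub_zero, add_zero] at h
  refine h.congr fun x => ?_
  unfold gaussMomentPrimitive
  ring

lemma gaussMomentPrimitive_nonneg {t x : ℝ} (h : t ≤ x) : 0 ≤ gaussMomentPrimitive t x := by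
  have hanti : AntitoneOn (gaussMomentPrimitive t) (Set.Ici t) := by
    refine antitoneOn_of_hasDerivWithinAt_nonpos (convex_Ici t)
      (fun y _ => (hasDerivAt_gaussMomentPrimitive t y).continuousAt.continuousWithinAt)
      (fun y _ => (hasDerivAt_gaussMomentPrimitive t y).hasDerivWithinAt) fun y hy => ?_
    rw [interior_Ici, Set.mem_Ioi] at hy
    have := sub_pos.mpr hy
    have : 0 ≤ (y - t) ^ 5 * exp (-(y ^ 2) / 2) := by positivity
    linarith
  refine le_of_tendsto (tendsto_gaussMomentPrimitive t) ?_
  filter_upwards [Filter.eventually_ge_atTop x] with y hy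
  exact hanti h (h.trans hy) hy

lemma gaussMoment_nonneg (t : ℝ) : 0 ≤ gaussMoment t := by
  rw [← gaussMomentPrimitive_self]
  exact gaussMomentPrimitive_nonneg le_rfl

lemma gaussMoment_neg (s : ℝ) :
    gaussMoment (-s) = gaussMoment s + √(2 * π) * (15 * s + 10 * s ^ 3 + s ^ 5) := by
  unfold gaussMoment
  rw [gaussTail_neg]
  ring_nf

lemma sqrt_two_pi_le : √(2 * π) ≤ 25067 / 10000 := by
  rw [sqrt_le_left (by norm_num)]
  have := pi_lt_d4
  norm_num at this ⊢
  linarith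

/-- A primitive of `(x - t)⁵ (1 - x² / 12)⁶`. -/
noncomputable def truncatedPrimitive (t x : ℝ) : ℝ :=
  ∑ k ∈ Finset.range 7, ∑ j ∈ Finset.range 6,
    ((Nat.choose 6 k : ℝ) * (-1 / 12) ^ k * ((Nat.choose 5 j : ℝ) * (-t) ^ (5 - j)) /
      (2 * k + j + 1 : ℕ)) * x ^ (2 * k + j + 1)

lemma hasDerivAt_truncatedPrimitive (t x : ℝ) :
    HasDerivAt (truncatedPrimitive t) ((x - t) ^ 5 * (1 - x ^ 2 / 12) ^ 6) x := by
  have h : HasDerivAt (truncatedPrimitive t) (∑ k ∈ Finset.range 7, ∑ j ∈ Finset.range 6,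
      ((Nat.choose 6 k : ℝ) * (-1 / 12) ^ k * ((Nat.choose 5 j : ℝ) * (-t) ^ (5 - j)) /
        (2 * k + j + 1 : ℕ)) * ((2 * k + j + 1 : ℕ) * x ^ (2 * k + j))) x :=
    HasDerivAt.fun_sum fun k _ => HasDerivAt.fun_sum fun j _ =>
      (hasDerivAt_pow (2 * k + j + 1) x).const_mul _
  refine h.congr_deriv ?_
  have h2 : ∀ k j : ℕ,
      ((Nat.choose 6 k : ℝ) * (-1 / 12) ^ k * ((Nat.choose 5 j : ℝ) * (-t) ^ (5 - j)) /
        (2 * k + j + 1 : ℕ)) * ((2 * k + j + 1 : ℕ) * x ^ (2 * k + j)) =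
      ((-(x ^ 2) / 12) ^ k * 1 ^ (6 - k) * (Nat.choose 6 k : ℝ)) *
        (x ^ j * (-t) ^ (5 - j) * (Nat.choose 5 j : ℝ)) := by
    intro k j
    have : ((2 * k + j + 1 : ℕ) : ℝ) ≠ 0 := by positivity
    rw [show -(x ^ 2) / 12 = -1 / 12 * x ^ 2 by ring, mul_pow, pow_add, pow_mul]
    field_simp
    ring
  simp only [h2, ← Finset.sum_mul_sum]
  rw [← add_pow, ← add_pow]
  ring

lemma truncated_le_gaussMoment {t : ℝ} (h0 : 0 ≤ t) (h3 : t ≤ 3) :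
    truncatedPrimitive t 3 - truncatedPrimitive t t ≤ gaussMoment t := by
  have hanti : AntitoneOn (fun x => gaussMomentPrimitive t x + truncatedPrimitive t x)
      (Set.Icc t 3) := by
    have hd := fun y =>
      (hasDerivAt_gaussMomentPrimitive t y).add (hasDerivAt_truncatedPrimitive t y)
    refine antitoneOn_of_hasDerivWithinAt_nonpos (convex_Icc t 3)
      (fun y _ => (hd y).continuousAt.continuousWithinAt)
      (fun y _ => (hd y).hasDerivWithinAt) fun y hy => ?_
    rw [interior_Icc] at hy
    have h1 := one_sub_pow_le_exp (h0.trans hy.1.le) hy.2.le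
    have h2 : 0 ≤ (y - t) ^ 5 := pow_nonneg (sub_nonneg.mpr hy.1.le) 5
    nlinarith [mul_le_mul_of_nonneg_left h1 h2]
  have h := hanti (Set.left_mem_Icc.mpr h3) (Set.right_mem_Icc.mpr h3) h3
  simp only [gaussMomentPrimitive_self] at h
  linarith [gaussMomentPrimitive_nonneg h3]

lemma gaussTail_le {t : ℝ} (h0 : 0 ≤ t) (h1 : t ≤ 1) :
    gaussTail t ≤ √(2 * π) / 2 - (t - t ^ 3 / 6 + t ^ 5 / 40 - t ^ 7 / 336) := by
  have hd : ∀ y, HasDerivAt (fun x : ℝ => gaussTail x + (x - x ^ 3 / 6 + x ^ 5 / 40 - x ^ 7 / 336))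
      (-exp (-(y ^ 2) / 2) + (1 - y ^ 2 / 2 + y ^ 4 / 8 - y ^ 6 / 48)) y := by
    intro y
    refine ((hasDerivAt_gaussTail y).add ((((hasDerivAt_id y).sub
      ((hasDerivAt_pow 3 y).div_const 6)).add ((hasDerivAt_pow 5 y).div_const 40)).sub
      ((hasDerivAt_pow 7 y).div_const 336))).congr_deriv ?_
    norm_num
    ring
  have hanti : AntitoneOn (fun x : ℝ => gaussTail x + (x - x ^ 3 / 6 + x ^ 5 / 40 - x ^ 7 / 336))
      (Set.Icc 0 1) := by
    refine antitoneOn_of_hasDerivWithinAt_nonpos (convex_Icc 0 1)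
      (fun y _ => (hd y).continuousAt.continuousWithinAt)
      (fun y _ => (hd y).hasDerivWithinAt) fun y hy => ?_
    rw [interior_Icc] at hy
    linarith [cubic_taylor_le_exp hy.1.le hy.2.le]
  have h := hanti (Set.left_mem_Icc.mpr zero_le_one) ⟨h0, h1⟩ h0
  simp only [gaussTail_zero] at h
  linarith

lemma gaussMoment_ge_of_le_one {t : ℝ} (h0 : 0 ≤ t) (h1 : t ≤ 1) :
    25067 / 10000 * (3125 / 93312 * (2 - t) ^ 6) ≤ gaussMoment t := by
  have hT : gaussTail t ≤ 25067 / 20000 - (t - t ^ 3 / 6 + t ^ 5 / 40 - t ^ 7 / 336) := by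
    linarith [gaussTail_le h0 h1, sqrt_two_pi_le]
  have hA := mul_le_mul_of_nonneg_left (cubic_taylor_le_exp h0 h1)
    (show 0 ≤ 8 + 9 * t ^ 2 + t ^ 4 by positivity)
  have hB := mul_le_mul_of_nonneg_left hT
    (show 0 ≤ t * (15 + 10 * t ^ 2 + t ^ 4) by positivity)
  have h2 : 0 ≤ 1 - t := by linarith
  have hP : 0 ≤
      61289 / 23328 * t ^ 0 * (1 - t) ^ 12 + 2336461 / 81000 * t ^ 1 * (1 - t) ^ 11 + 558898033
      / 3888000 * t ^ 2 * (1 - t) ^ 10 + 139289941 / 324000 * t ^ 3 * (1 - t) ^ 9 + 13364748677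
      / 15552000 * t ^ 4 * (1 - t) ^ 8 + 31357708373 / 25920000 * t ^ 5 * (1 - t) ^ 7 +
      1147968334421 / 933120000 * t ^ 6 * (1 - t) ^ 6 + 47221478021 / 51840000 * t ^ 7 * (1 - t)
      ^ 5 + 212330887763 / 435456000 * t ^ 8 * (1 - t) ^ 4 + 333980971 / 1814400 * t ^ 9 * (1 -
      t) ^ 3 + 101136752447 / 2177280000 * t ^ 10 * (1 - t) ^ 2 + 2527383599 / 362880000 * t ^
      11 * (1 - t) ^ 1 + 2895152111 / 6531840000 * t ^ 12 * (1 - t) ^ 0 := by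
    positivity
  unfold gaussMoment
  linarith

lemma gaussMoment_ge_of_one_le {t : ℝ} (h1 : 1 ≤ t) (h2 : t ≤ 2) :
    25067 / 10000 * (3125 / 93312 * (2 - t) ^ 6) ≤ gaussMoment t := by
  have h := truncated_le_gaussMoment (by linarith : 0 ≤ t) (by linarith)
  have h3 : 0 ≤ t - 1 := by linarith
  have h4 : 0 ≤ 2 - t := by linarith
  have hP : 0 ≤
      40955101 / 2969561088 * (t - 1) ^ 0 * (2 - t) ^ 18 + 2071642343 / 6351561216 * (t - 1) ^ 1
      * (2 - t) ^ 17 + 204044993 / 67931136 * (t - 1) ^ 2 * (2 - t) ^ 16 + 17588177287 /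
      1120863744 * (t - 1) ^ 3 * (2 - t) ^ 15 + 314930095 / 5837832 * (t - 1) ^ 4 * (2 - t) ^ 14
      + 196939276481 / 1494484992 * (t - 1) ^ 5 * (2 - t) ^ 13 + 330002012957 / 1379524608 * (t
      - 1) ^ 6 * (2 - t) ^ 12 + 19074035573 / 57480192 * (t - 1) ^ 7 * (2 - t) ^ 11 +
      29935101131 / 83607552 * (t - 1) ^ 8 * (2 - t) ^ 10 + 57144930835 / 188116992 * (t - 1) ^
      9 * (2 - t) ^ 9 + 8521987261 / 41803776 * (t - 1) ^ 10 * (2 - t) ^ 8 + 141590719 / 1306368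
      * (t - 1) ^ 11 * (2 - t) ^ 7 + 31399273687 / 689762304 * (t - 1) ^ 12 * (2 - t) ^ 6 +
      2033606047 / 135862272 * (t - 1) ^ 13 * (2 - t) ^ 5 + 22612512385 / 5977939968 * (t - 1) ^
      14 * (2 - t) ^ 4 + 1592232875 / 2241727488 * (t - 1) ^ 15 * (2 - t) ^ 3 + 2231444693 /
      23911759872 * (t - 1) ^ 16 * (2 - t) ^ 2 + 778067699 / 101624979456 * (t - 1) ^ 17 * (2 -
      t) ^ 1 + 270009473 / 914624815104 * (t - 1) ^ 18 * (2 - t) ^ 0 := by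
    positivity
  refine le_trans ?_ h
  simp only [truncatedPrimitive, Finset.sum_range_succ, Finset.sum_range_zero]
  norm_num [Nat.choose]
  linarith

lemma gaussMoment_ge {t : ℝ} (h0 : 0 ≤ t) (h2 : t ≤ 2) :
    √(2 * π) * (3125 / 93312 * (2 - t) ^ 6) ≤ gaussMoment t := by
  have h : √(2 * π) * (3125 / 93312 * (2 - t) ^ 6) ≤
      25067 / 10000 * (3125 / 93312 * (2 - t) ^ 6) :=
    mul_le_mul_of_nonneg_right sqrt_two_pi_le (by positivity)
  rcases le_total t 1 with h1 | h1
  · exact h.trans (gaussMoment_ge_of_le_one h0 h1)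
  · exact h.trans (gaussMoment_ge_of_one_le h1 h2)

lemma gaussMoment_ge_of_abs_le {t : ℝ} (h1 : -2 ≤ t) (h2 : t ≤ 2) :
    √(2 * π) * (3125 / 93312 * (2 - t) ^ 6) ≤ gaussMoment t := by
  rcases le_total 0 t with h0 | h0
  · exact gaussMoment_ge h0 h2
  obtain ⟨s, rfl⟩ : ∃ s, t = -s := ⟨-t, by ring⟩
  have hs : 0 ≤ s := by linarith
  rw [gaussMoment_neg]
  have h := gaussMoment_ge hs (by linarith)
  have hp : 3125 / 93312 * (2 - -s) ^ 6 ≤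
      3125 / 93312 * (2 - s) ^ 6 + (15 * s + 10 * s ^ 3 + s ^ 5) := by
    linarith [mul_nonneg hs (sq_nonneg (s ^ 2 - 2)), pow_nonneg hs 3]
  calc √(2 * π) * (3125 / 93312 * (2 - -s) ^ 6)
      ≤ √(2 * π) * (3125 / 93312 * (2 - s) ^ 6 + (15 * s + 10 * s ^ 3 + s ^ 5)) := by gcongr
    _ ≤ _ := by linarith

lemma mul_pow_five_le {a b : ℝ} (ha : 0 ≤ a) (hb : 0 ≤ b) :
    a * b ^ 5 ≤ 3125 / 93312 * (2 * a + b) ^ 6 := by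
  have : 0 ≤ (b - 10 * a) ^ 2 *
      (3125 * b ^ 4 + 6688 * a * b ^ 3 + 8760 * a ^ 2 * b ^ 2 + 6400 * a ^ 3 * b +
        2000 * a ^ 4) := by positivity
  linarith

/-- The difference between `15 s + 10 s³ + s⁵` and the fifth moment of `X + s`, where `X` takes the
value `u - 1` with probability `(1 + u) / 2` and `u + 1` with probability `(1 - u) / 2`. -/
def momentGap (s u : ℝ) : ℝ :=
  10 * s ^ 3 * u ^ 2 - 20 * s ^ 2 * u * (1 - u ^ 2) + 5 * s * (2 - 2 * u ^ 2 + 3 * u ^ 4) -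
    4 * u * (1 - u ^ 4)

lemma momentGap_eq (s u : ℝ) : momentGap s u =
    10 * s * (s * u - (1 - u ^ 2)) ^ 2 + 10 * s * u ^ 2 * (1 - u ^ 2) + 15 * s * u ^ 4 -
      4 * u * (1 - u ^ 2) * (1 + u ^ 2) := by
  unfold momentGap
  ring

lemma momentGap_mono {u s₀ s : ℝ} (hu : 9 / 20 ≤ u) (h : s₀ ≤ s) :
    momentGap s₀ u ≤ momentGap s u := by
  have hw : 0 ≤ 3 * (2 - 2 * u ^ 2 + 3 * u ^ 4) - 8 * (1 - u ^ 2) ^ 2 := by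
    have : 81 / 400 ≤ u ^ 2 := by nlinarith
    nlinarith
  have hs : 0 ≤ s - s₀ := by linarith
  have : 0 ≤ (s - s₀) * (5 / 2 * u ^ 2 * (s - s₀) ^ 2 +
      15 / 2 * (u * (s + s₀) - 4 / 3 * (1 - u ^ 2)) ^ 2 +
      5 / 3 * (3 * (2 - 2 * u ^ 2 + 3 * u ^ 4) - 8 * (1 - u ^ 2) ^ 2)) := by positivity
  unfold momentGap
  linarith

lemma momentGap_nonneg_of_le {u s : ℝ} (hu0 : 0 ≤ u) (hu : u ≤ 9 / 20) (hs : 1 - u ≤ s) :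
    0 ≤ momentGap s u := by
  rw [momentGap_eq]
  have hs0 : 0 ≤ s := by linarith
  have hq : 0 ≤ 1 - u ^ 2 := by nlinarith
  rcases le_total (2 / 5 * (1 + u ^ 2)) (s * u) with h | h
  · have h1 : 0 ≤ (s * u - 2 / 5 * (1 + u ^ 2)) * (10 * u * (1 - u ^ 2)) :=
      mul_nonneg (by linarith) (by positivity)
    have h2 : 0 ≤ 10 * s * (s * u - (1 - u ^ 2)) ^ 2 + 15 * s * u ^ 4 := by positivity
    linarith
  · have h0 : 0 ≤ 3 / 5 - 7 / 5 * u ^ 2 := by nlinarith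
    have h1 : (3 / 5 - 7 / 5 * u ^ 2) ^ 2 ≤ (s * u - (1 - u ^ 2)) ^ 2 := by
      rw [← neg_sq (s * u - (1 - u ^ 2))]
      exact pow_le_pow_left₀ h0 (by linarith) 2
    have h2 : 18 / 5 - 34 / 5 * u ^ 2 + 123 / 5 * u ^ 4 ≤
        10 * (s * u - (1 - u ^ 2)) ^ 2 + 10 * u ^ 2 * (1 - u ^ 2) + 15 * u ^ 4 := by linarith
    have h3 : 0 ≤ 9 / 20 - u := by linarith
    have h4 : 0 ≤
      64000 / 729 * u ^ 0 * (9 / 20 - u) ^ 4 + 224000 / 729 * u ^ 1 * (9 / 20 - u) ^ 3 + 27680 /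
      81 * u ^ 2 * (9 / 20 - u) ^ 2 + 75760 / 729 * u ^ 3 * (9 / 20 - u) ^ 1 + 8287 / 3645 * u ^
      4 * (9 / 20 - u) ^ 0 := by
      positivity
    have h5 : 4 * u * (1 + u) * (1 + u ^ 2) ≤
        10 * (s * u - (1 - u ^ 2)) ^ 2 + 10 * u ^ 2 * (1 - u ^ 2) + 15 * u ^ 4 := by linarith
    have h6 : (1 - u) * (4 * u * (1 + u) * (1 + u ^ 2)) ≤
        s * (10 * (s * u - (1 - u ^ 2)) ^ 2 + 10 * u ^ 2 * (1 - u ^ 2) + 15 * u ^ 4) :=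
      mul_le_mul hs h5 (by positivity) hs0
    linarith

lemma momentGap_nonneg {u s : ℝ} (h0 : -1 ≤ u) (h1 : u ≤ 1) (hs : 1 - u ≤ s)
    (hs3 : 1 / 3 ≤ s) : 0 ≤ momentGap s u := by
  rcases le_total u 0 with hu | hu
  · rw [momentGap_eq]
    have hq : 0 ≤ 1 - u ^ 2 := by nlinarith
    have hs0 : 0 ≤ s := by linarith
    have hv : 0 ≤ -u := by linarith
    have : 0 ≤ 10 * s * (s * u - (1 - u ^ 2)) ^ 2 + 10 * s * u ^ 2 * (1 - u ^ 2) + 15 * s * u ^ 4 +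
      4 * (-u) * (1 - u ^ 2) * (1 + u ^ 2) := by positivity
    linarith
  rcases le_total u (9 / 20) with hu2 | hu2
  · exact momentGap_nonneg_of_le hu hu2 hs
  have h3 : 0 ≤ u - 9 / 20 := by linarith
  rcases le_total u (2 / 3) with hu3 | hu3
  · refine le_trans ?_ (momentGap_mono hu2 hs)
    have h4 : 0 ≤ 2 / 3 - u := by linarith
    have h5 : 0 ≤
      905187393 / 371293 * (u - 9 / 20) ^ 0 * (2 / 3 - u) ^ 5 + 3088376100 / 371293 * (u - 9 /
      20) ^ 1 * (2 / 3 - u) ^ 4 + 3964680000 / 371293 * (u - 9 / 20) ^ 2 * (2 / 3 - u) ^ 3 +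
      2312640000 / 371293 * (u - 9 / 20) ^ 3 * (2 / 3 - u) ^ 2 + 563520000 / 371293 * (u - 9 /
      20) ^ 4 * (2 / 3 - u) ^ 1 + 32000000 / 371293 * (u - 9 / 20) ^ 5 * (2 / 3 - u) ^ 0 := by
      positivity
    unfold momentGap
    linarith
  · refine le_trans ?_ (momentGap_mono hu2 hs3)
    have h4 : 0 ≤ u - 2 / 3 := by linarith
    have h6 : 0 ≤ 1 - u := by linarith
    have h5 : 0 ≤
      10 * (u - 2 / 3) ^ 0 * (1 - u) ^ 5 + 266 * (u - 2 / 3) ^ 1 * (1 - u) ^ 4 + 1684 * (u - 2 /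
      3) ^ 2 * (1 - u) ^ 3 + 3856 * (u - 2 / 3) ^ 3 * (1 - u) ^ 2 + 3729 * (u - 2 / 3) ^ 4 * (1
      - u) ^ 1 + 1305 * (u - 2 / 3) ^ 5 * (1 - u) ^ 0 := by
      positivity
    unfold momentGap
    linarith

lemma neg_momentGap_le {u s : ℝ} (h1 : u ≤ 1) (hs : 1 - u ≤ s) (hs3 : s ≤ 1 / 3) :
    -momentGap s u ≤ 3125 / 93312 * (2 - s) ^ 6 := by
  have hb : 64 * (1 - 3 * s) ≤ (2 - s) ^ 6 := by
    have h := one_add_mul_le_pow (a := -s / 2) (by linarith) 6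
    norm_num at h
    linarith
  have h4 : 0 ≤ 1 - 3 * s := by linarith
  have h5 : 0 ≤ s - (1 - u) := by linarith
  have h6 : 0 ≤ 1 - u := by linarith
  have h7 : 0 ≤
      10 / 243 * (1 - 3 * s) ^ 0 * (3 * (s - (1 - u))) ^ 0 * (3 * (1 - u)) ^ 5 + 266 / 243 * (1
      - 3 * s) ^ 0 * (3 * (s - (1 - u))) ^ 1 * (3 * (1 - u)) ^ 4 + 1684 / 243 * (1 - 3 * s) ^ 0
      * (3 * (s - (1 - u))) ^ 2 * (3 * (1 - u)) ^ 3 + 3856 / 243 * (1 - 3 * s) ^ 0 * (3 * (s -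
      (1 - u))) ^ 3 * (3 * (1 - u)) ^ 2 + 1243 / 81 * (1 - 3 * s) ^ 0 * (3 * (s - (1 - u))) ^ 4
      * (3 * (1 - u)) ^ 1 + 145 / 27 * (1 - 3 * s) ^ 0 * (3 * (s - (1 - u))) ^ 5 * (3 * (1 - u))
      ^ 0 + 2261 / 1458 * (1 - 3 * s) ^ 1 * (3 * (s - (1 - u))) ^ 0 * (3 * (1 - u)) ^ 4 + 10354
      / 729 * (1 - 3 * s) ^ 1 * (3 * (s - (1 - u))) ^ 1 * (3 * (1 - u)) ^ 3 + 10613 / 243 * (1 -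
      3 * s) ^ 1 * (3 * (s - (1 - u))) ^ 2 * (3 * (1 - u)) ^ 2 + 39118 / 729 * (1 - 3 * s) ^ 1 *
      (3 * (s - (1 - u))) ^ 3 * (3 * (1 - u)) ^ 1 + 33365 / 1458 * (1 - 3 * s) ^ 1 * (3 * (s -
      (1 - u))) ^ 4 * (3 * (1 - u)) ^ 0 + 5062 / 729 * (1 - 3 * s) ^ 2 * (3 * (s - (1 - u))) ^ 0
      * (3 * (1 - u)) ^ 3 + 9598 / 243 * (1 - 3 * s) ^ 2 * (3 * (s - (1 - u))) ^ 1 * (3 * (1 -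
      u)) ^ 2 + 17014 / 243 * (1 - 3 * s) ^ 2 * (3 * (s - (1 - u))) ^ 2 * (3 * (1 - u)) ^ 1 +
      28390 / 729 * (1 - 3 * s) ^ 2 * (3 * (s - (1 - u))) ^ 3 * (3 * (1 - u)) ^ 0 + 2801 / 243 *
      (1 - 3 * s) ^ 3 * (3 * (s - (1 - u))) ^ 0 * (3 * (1 - u)) ^ 2 + 9706 / 243 * (1 - 3 * s) ^
      3 * (3 * (s - (1 - u))) ^ 1 * (3 * (1 - u)) ^ 1 + 7985 / 243 * (1 - 3 * s) ^ 3 * (3 * (s -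
      (1 - u))) ^ 2 * (3 * (1 - u)) ^ 0 + 6007 / 729 * (1 - 3 * s) ^ 4 * (3 * (s - (1 - u))) ^ 0
      * (3 * (1 - u)) ^ 1 + 9895 / 729 * (1 - 3 * s) ^ 4 * (3 * (s - (1 - u))) ^ 1 * (3 * (1 -
      u)) ^ 0 + 3125 / 1458 * (1 - 3 * s) ^ 5 * (3 * (s - (1 - u))) ^ 0 * (3 * (1 - u)) ^ 0 := by
    positivity
  unfold momentGap
  linarith

lemma gaussMoment_add_momentGap_nonneg {u s : ℝ} (h0 : -1 ≤ u) (h1 : u ≤ 1) (hs : 1 - u ≤ s) :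
    0 ≤ gaussMoment s + √(2 * π) * momentGap s u := by
  rcases le_total (1 / 3) s with hs3 | hs3
  · have := momentGap_nonneg h0 h1 hs hs3
    have := gaussMoment_nonneg s
    positivity
  · have h := gaussMoment_ge (t := s) (by linarith) (by linarith)
    have h2 := mul_le_mul_of_nonneg_left (neg_momentGap_le h1 hs hs3) (sqrt_nonneg (2 * π))
    linarith

lemma two_point_le_gaussMoment {r t : ℝ} (hr0 : 0 ≤ r) (hr1 : r ≤ 1) :
    √(2 * π) * (r * max 0 (2 * r - 2 - t) ^ 5 + (1 - r) * max 0 (2 * r - t) ^ 5) ≤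
      gaussMoment t := by
  rcases le_total (2 * r) t with h | h
  · rw [max_eq_left (by linarith), max_eq_left (by linarith)]
    simpa using gaussMoment_nonneg t
  rw [max_eq_right (by linarith : 0 ≤ 2 * r - t)]
  rcases le_total (2 * r - 2) t with h2 | h2
  · rw [max_eq_left (by linarith)]
    refine le_trans ?_ (gaussMoment_ge_of_abs_le (t := t) (by linarith) (by linarith))
    refine mul_le_mul_of_nonneg_left ?_ (sqrt_nonneg _)
    have := mul_pow_five_le (sub_nonneg.mpr hr1) (sub_nonneg.mpr h)
    rw [show 2 * (1 - r) + (2 * r - t) = 2 - t by ring] at this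
    simpa using this
  · rw [max_eq_right (by linarith)]
    have hg := gaussMoment_add_momentGap_nonneg (u := 2 * r - 1) (s := -t) (by linarith)
      (by linarith) (by linarith)
    have hn := gaussMoment_neg (-t)
    rw [neg_neg] at hn
    rw [hn, ← sub_nonneg]
    refine hg.trans_eq ?_
    unfold momentGap
    ring

/-- the key two-point inequality `L(r,t) ≤ R(t)`, where the right-hand
side equals `E (Z - t)₊⁵` for a standard normal `Z`. -/
theorem two_point_inequality (r t : ℝ) (hr0 : 0 ≤ r) (hr1 : r ≤ 1) :
    r * max 0 (2 * r - 2 - t) ^ 5 + (1 - r) * max 0 (2 * r - t) ^ 5 ≤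
      (8 + 9 * t ^ 2 + t ^ 4) * ((Real.sqrt (2 * Real.pi))⁻¹ * Real.exp (-(t ^ 2) / 2)) -
        t * (15 + 10 * t ^ 2 + t ^ 4) *
          ∫ u in Set.Ioi t, (Real.sqrt (2 * Real.pi))⁻¹ * Real.exp (-(u ^ 2) / 2) := by
  have hpos : 0 < √(2 * π) := by positivity
  have h := two_point_le_gaussMoment (t := t) hr0 hr1
  rw [MeasureTheory.integral_const_mul]
  change _ ≤ _ - _ * (_ * gaussTail t)
  refine le_of_mul_le_mul_left (h.trans_eq ?_) hpos
  unfold gaussMoment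
  field_simp
end
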